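/- Let m and N be positive integers with N > m. Then the subspace S^{2Nm−1} \ Φ(N) of the unit sphere of Hom(ℂ^N, ℂ^m), consisting of all surjective linear maps of Frobenius norm 1, is (2N − 2m)-connected: it is nonempty and path-connected, and for every base point its homotopy group π_k is trivial for all k with 1 ≤ k ≤ 2N − 2m. -/

import Mathlib

open Function Topology

/-- The Frobenius (Euclidean) norm of an `m × N` complex matrix. -/
noncomputable def frobNorm {m N : ℕ} (A : Matrix (Fin m) (Fin N) ℂ) : ℝ :=
  Real.sqrt (∑ i, ∑ j, ‖A i j‖ ^ 2)

section GenericTranslation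

variable {E F P ι : Type*} [NormedAddCommGroup E] [NormedSpace ℝ E] [FiniteDimensional ℝ E]
  [NormedAddCommGroup F] [NormedSpace ℝ F] [FiniteDimensional ℝ F]
  [NormedAddCommGroup P] [NormedSpace ℝ P] [FiniteDimensional ℝ P] [Countable ι]

/-- For a `C¹` map `f` and countably many `C¹` maps `g i` whose source dimensions add up to less
than the dimension of the target, a generic translate of `f` misses every `g i`. -/
theorem dense_setOf_forall_add_ne {f : E → F} (hf : ContDiff ℝ 1 f) {g : ι → P → F}
    (hg : ∀ i, ContDiff ℝ 1 (g i))
    (hd : Module.finrank ℝ E + Module.finrank ℝ P < Module.finrank ℝ F) :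
    Dense {v : F | ∀ x i p, f x + v ≠ g i p} := by
  have hdim : dimH (⋃ i, Set.range fun q : E × P ↦ g i q.2 - f q.1) < Module.finrank ℝ F := by
    rw [dimH_iUnion]
    refine (iSup_le fun i ↦ ?_).trans_lt (Nat.cast_lt.2 hd)
    rw [← Module.finrank_prod]
    have := hg i
    exact ContDiff.dimH_range_le (by fun_prop)
  refine (dense_compl_of_dimH_lt_finrank hdim).mono ?_
  intro v hv x i p h
  exact hv (Set.mem_iUnion.2 ⟨i, (x, p), by simp [← h]⟩)

end GenericTranslation

namespace GenLoop

open scoped unitInterval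

variable {n X Y : Type*} [TopologicalSpace X] [TopologicalSpace Y]

/-- The end of a homotopy fixed on the boundary of the cube and starting at a generalized loop is
a homotopic generalized loop. -/
theorem exists_homotopic_of_homotopy {x : X} (p : GenLoop n X x) (h : C(I × (n → I), X))
    (h_zero : ∀ y, h (0, y) = p y) (h_boundary : ∀ t, ∀ y ∈ Cube.boundary n, h (t, y) = x) :
    ∃ q : GenLoop n X x, Homotopic p q ∧ ∀ y, q y = h (1, y) := by
  refine ⟨⟨⟨fun y ↦ h (1, y), by fun_prop⟩, h_boundary 1⟩, ⟨⟨⟨h, h_zero, fun _ ↦ rfl⟩, ?_⟩⟩,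
    fun _ ↦ rfl⟩
  intro t y hy
  exact (h_boundary t y hy).trans (p.2 y hy).symm

/-- The homotopy groups of a retract of a space with trivial homotopy group are trivial. -/
theorem subsingleton_homotopyGroup_of_retract (i : C(X, Y)) (r : C(Y, X))
    (hri : ∀ x, r (i x) = x) (x : X)
    (h : ∀ p : GenLoop n Y (i x), Homotopic p const) : Subsingleton (HomotopyGroup n X x) := by
  have key (p : GenLoop n X x) : Homotopic p const := by
    have := (h ⟨i.comp p.1, fun y hy ↦ congrArg i (p.2 y hy)⟩).comp_continuousMap r
    have hp : r.comp (i.comp p.1) = p.1 := by ext y; exact hri _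
    have hc : r.comp (const : GenLoop n Y (i x)).1 = (const : GenLoop n X x).1 := by
      ext y; exact hri _
    rw [hp, hc] at this
    exact this
  exact ⟨Quotient.ind₂ fun p q ↦ Quotient.sound ((key p).trans (key q).symm)⟩

end GenLoop

section Cutoff

variable {F : Type*} [PseudoMetricSpace F]

/-- A continuous cutoff function, equal to `1` on the ball of radius `δ / 2` around `x₀` and
vanishing outside the ball of radius `δ`. -/
noncomputable def ballCutoff (x₀ : F) (δ : ℝ) (y : F) : ℝ :=
  max 0 (min 1 (2 - 2 * dist y x₀ / δ))

theorem continuous_ballCutoff (x₀ : F) (δ : ℝ) : Continuous (ballCutoff x₀ δ) := by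
  unfold ballCutoff
  fun_prop

theorem ballCutoff_nonneg (x₀ : F) (δ : ℝ) (y : F) : 0 ≤ ballCutoff x₀ δ y := le_max_left _ _

theorem ballCutoff_le_one (x₀ : F) (δ : ℝ) (y : F) : ballCutoff x₀ δ y ≤ 1 :=
  max_le zero_le_one (min_le_left _ _)

theorem ballCutoff_eq_one {x₀ : F} {δ : ℝ} (hδ : 0 < δ) {y : F} (hy : dist y x₀ ≤ δ / 2) :
    ballCutoff x₀ δ y = 1 := by
  have : 2 * dist y x₀ / δ ≤ 1 := by rw [div_le_one hδ]; linarith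
  rw [ballCutoff, min_eq_left (by linarith), max_eq_right zero_le_one]

theorem ballCutoff_eq_zero {x₀ : F} {δ : ℝ} (hδ : 0 < δ) {y : F} (hy : δ ≤ dist y x₀) :
    ballCutoff x₀ δ y = 0 := by
  have : 2 ≤ 2 * dist y x₀ / δ := by rw [le_div_iff₀ hδ]; linarith
  exact max_eq_left ((min_le_right _ _).trans (by linarith))

end Cutoff

section GeneralPosition

open scoped unitInterval

variable {F : Type*} [NormedAddCommGroup F] [NormedSpace ℝ F]

/-- Moving points of a small ball towards its centre preserves any set containing the ball. -/
theorem add_ballCutoff_smul_mem {U : Set F} {x₀ y : F} {δ t : ℝ} (hδ : 0 < δ)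
    (hball : Metric.ball x₀ δ ⊆ U) (hy : y ∈ U) (ht : t ∈ Set.Icc (0 : ℝ) 1) :
    y + (t * ballCutoff x₀ δ y) • (x₀ - y) ∈ U := by
  rcases lt_or_ge (dist y x₀) δ with h | h
  · refine hball ((convex_ball x₀ δ).add_smul_sub_mem h (Metric.mem_ball_self hδ) ⟨?_, ?_⟩)
    · exact mul_nonneg ht.1 (ballCutoff_nonneg _ _ _)
    · exact mul_le_one₀ ht.2 (ballCutoff_nonneg _ _ _) (ballCutoff_le_one _ _ _)
  · simpa [ballCutoff_eq_zero hδ h] using hy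

/-- If generic translates of `C¹` maps from a space of dimension `k + 1` land in the open set `U`,
then every `k`-dimensional loop in `U` is null-homotopic. -/
theorem GenLoop.homotopic_const_of_dense_translates {k : ℕ} {U : Set F} (hU : IsOpen U)
    (hgen : ∀ f : (Fin k → ℝ) × ℝ → F, ContDiff ℝ 1 f → Dense {v | ∀ x, f x + v ∈ U})
    (x₀ : U) (p : GenLoop (Fin k) U x₀) : Homotopic p const := by
  obtain ⟨δ, hδ, hthick⟩ : ∃ δ, 0 < δ ∧
      Metric.thickening δ (insert (x₀ : F) (Set.range fun y ↦ (p y : F))) ⊆ U := by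
    refine IsCompact.exists_thickening_subset_open ?_ hU ?_
    · exact (isCompact_range (continuous_subtype_val.comp p.1.continuous)).insert _
    · rintro _ (rfl | ⟨y, rfl⟩)
      exacts [x₀.2, (p y).2]
  have hball : Metric.ball (x₀ : F) δ ⊆ U := fun z hz ↦
    hthick (Metric.mem_thickening_iff.2 ⟨x₀, Set.mem_insert _ _, hz⟩)
  have hballp (y) : Metric.ball (p y : F) δ ⊆ U := fun z hz ↦
    hthick (Metric.mem_thickening_iff.2 ⟨p y, Set.mem_insert_of_mem _ ⟨y, rfl⟩, hz⟩)
  have hpc : Continuous fun y : Fin k → I ↦ (p y : F) :=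
    continuous_subtype_val.comp p.1.continuous
  have hpx (y) (hy : y ∈ Cube.boundary (Fin k)) : (p y : F) = x₀ := congrArg _ (p.2 y hy)
  obtain ⟨g, hg, hgp, -⟩ := Continuous.exists_contDiff_approx 1
    (f := fun y : Fin k → ℝ ↦ (p fun i ↦ Set.projIcc 0 1 zero_le_one (y i) : F))
    (ε := fun _ ↦ δ / 4)
    (hpc.comp (continuous_pi fun i ↦ continuous_projIcc.comp (continuous_apply i)))
    continuous_const (fun _ ↦ by positivity)
  replace hgp (y : Fin k → I) : dist (g fun i ↦ y i) (p y : F) < δ / 4 := by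
    simpa using hgp fun i ↦ y i
  have hg1 : ContDiff ℝ 1 g := hg
  have hgc : Continuous fun y : Fin k → I ↦ g fun i ↦ y i := hg.continuous.comp (by fun_prop)
  obtain ⟨v, hv, hvδ⟩ := (hgen (fun x ↦ g x.1 + x.2 • ((x₀ : F) - g x.1))
    (by fun_prop)).exists_dist_lt 0 (ε := δ / 4) (by positivity)
  rw [dist_zero_left] at hvδ
  have hc := continuous_ballCutoff (x₀ : F) δ
  set ρ : F → F := fun y ↦ y + ballCutoff (x₀ : F) δ y • ((x₀ : F) - y)
  have hρc : Continuous ρ := by fun_prop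
  have hρU {y : F} (hy : y ∈ U) : ρ y ∈ U := by
    simpa using add_ballCutoff_smul_mem hδ hball hy (t := 1) (by simp)
  have hρ {y : F} (hy : dist y x₀ ≤ δ / 2) : ρ y = x₀ := by
    simp [ρ, ballCutoff_eq_one hδ hy]
  have hmid (t : I) (y : Fin k → I) :
      dist ((p y : F) + (t : ℝ) • (g (fun i ↦ y i) + v - p y)) (p y) < δ / 2 := by
    have h₁ : ‖g (fun i ↦ y i) + v - p y‖ < δ / 2 := by
      rw [add_sub_right_comm]
      refine (norm_add_le _ _).trans_lt ?_
      rw [← dist_eq_norm]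
      linarith [hgp y]
    rw [dist_self_add_left, norm_smul, Real.norm_of_nonneg t.2.1]
    exact (mul_le_of_le_one_left (norm_nonneg _) t.2.2).trans_lt h₁
  -- Squeeze the values close to the base point onto the base point.
  obtain ⟨p₁, hp₁, hp₁v⟩ := exists_homotopic_of_homotopy p
    ⟨fun z ↦ ⟨(p z.2 : F) + ((z.1 : ℝ) * ballCutoff (x₀ : F) δ (p z.2)) • ((x₀ : F) - p z.2),
      add_ballCutoff_smul_mem hδ hball (p z.2).2 z.1.2⟩, by fun_prop⟩
    (fun y ↦ by simp) (fun t y hy ↦ by ext1; simp [hpx y hy])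
  obtain ⟨p₂, hp₂, hp₂v⟩ := exists_homotopic_of_homotopy p₁
    ⟨fun z ↦ ⟨ρ ((p z.2 : F) + (z.1 : ℝ) • (g (fun i ↦ z.2 i) + v - p z.2)),
      hρU (hballp z.2 ((hmid z.1 z.2).trans (by linarith)))⟩, by fun_prop⟩
    (fun y ↦ by ext1; simp [hp₁v, ρ])
    (fun t y hy ↦ by
      ext1
      have := hmid t y
      rw [hpx y hy] at this
      simpa only [ContinuousMap.coe_mk, hpx y hy] using hρ this.le)
  obtain ⟨p₃, hp₃, hp₃v⟩ := exists_homotopic_of_homotopy p₂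
    ⟨fun z ↦ ⟨ρ (g (fun i ↦ z.2 i) + (z.1 : ℝ) • ((x₀ : F) - g fun i ↦ z.2 i) + v),
      hρU (hv (fun i ↦ z.2 i, z.1))⟩, by fun_prop⟩
    (fun y ↦ by ext1; simp [hp₂v])
    (fun t y hy ↦ by
      ext1
      refine hρ ?_
      have hgx := hgp y
      rw [hpx y hy, dist_comm, dist_eq_norm] at hgx
      rw [dist_eq_norm, show g (fun i ↦ y i) +
        (t : ℝ) • ((x₀ : F) - g fun i ↦ y i) + v - x₀ =
          v - (1 - (t : ℝ)) • ((x₀ : F) - g fun i ↦ y i) by module]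
      refine (norm_sub_le _ _).trans ?_
      rw [norm_smul, Real.norm_of_nonneg (sub_nonneg.2 t.2.2)]
      have := mul_le_of_le_one_left (norm_nonneg ((x₀ : F) - g fun i ↦ y i))
        (sub_le_self 1 t.2.1)
      linarith)
  have hp₃c : p₃ = const := by
    ext y
    rw [hp₃v]
    refine hρ ?_
    simpa using by linarith
  exact hp₃c ▸ (hp₁.trans hp₂).trans hp₃

end GeneralPosition

section FullRank

variable {m N : ℕ}

theorem Matrix.surjective_mulVecLin_iff_linearIndependent (A : Matrix (Fin m) (Fin N) ℂ) :
    Surjective A.mulVecLin ↔ LinearIndependent ℂ (fun i ↦ A i) := by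
  have h₁ : A.rank = Module.finrank ℂ (Submodule.span ℂ (Set.range A.row)) :=
    A.rank_eq_finrank_span_row
  rw [← LinearMap.range_eq_top, show (fun i ↦ A i) = A.row from rfl,
    linearIndependent_iff_card_eq_finrank_span, Set.finrank, ← h₁, Fintype.card_fin, Matrix.rank]
  constructor
  · intro h
    rw [h, finrank_top, Module.finrank_fin_fun]
  · intro h
    apply Submodule.eq_top_of_finrank_eq
    rw [← h, Module.finrank_fin_fun]

/-- The families of vectors whose `i`-th member is the linear combination of the others with the
given coefficients. -/
def insertCombination (i : Fin (m + 1)) (q : (Fin m → ℂ) × (Fin m → Fin N → ℂ)) :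
    Fin (m + 1) → Fin N → ℂ :=
  i.insertNth (∑ j, q.1 j • q.2 j) q.2

theorem contDiff_insertCombination (i : Fin (m + 1)) :
    ContDiff ℝ 1 (insertCombination (N := N) i) := by
  refine contDiff_pi.2 ((Fin.forall_iff_succAbove i).2 ⟨?_, fun j ↦ ?_⟩)
  · simp only [insertCombination, Fin.insertNth_apply_same]
    fun_prop
  · simp only [insertCombination, Fin.insertNth_apply_succAbove]
    fun_prop

theorem exists_eq_insertCombination {A : Fin (m + 1) → Fin N → ℂ}
    (hA : ¬ LinearIndependent ℂ A) : ∃ i q, A = insertCombination i q := by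
  obtain ⟨c, hc, i, hi⟩ := Fintype.not_linearIndependent_iff.1 hA
  refine ⟨i, (fun j ↦ -((c i)⁻¹ * c (i.succAbove j)), fun j ↦ A (i.succAbove j)),
    funext ((Fin.forall_iff_succAbove i).2 ⟨?_, fun j ↦ ?_⟩)⟩
  · rw [Fin.sum_univ_succAbove _ i] at hc
    have : A i = -((c i)⁻¹ • ∑ j, c (i.succAbove j) • A (i.succAbove j)) := by
      rw [← smul_neg, ← eq_neg_of_add_eq_zero_left hc, inv_smul_smul₀ hi]
    simpa [insertCombination, Finset.smul_sum, mul_smul] using this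
  · simp [insertCombination]

theorem dense_setOf_forall_linearIndependent_add {k : ℕ} (hm : 0 < m) (hN : m < N)
    (hk : k ≤ 2 * N - 2 * m) (f : (Fin k → ℝ) × ℝ → Fin m → Fin N → ℂ) (hf : ContDiff ℝ 1 f) :
    Dense {v | ∀ x, f x + v ∈ {A : Fin m → Fin N → ℂ | LinearIndependent ℂ A}} := by
  obtain ⟨m, rfl⟩ := Nat.exists_eq_succ_of_ne_zero hm.ne'
  refine (dense_setOf_forall_add_ne hf
    (fun i : Fin (m + 1) ↦ contDiff_insertCombination (N := N) i) ?_).mono ?_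
  · simp only [Module.finrank_prod, Module.finrank_pi_fintype, Module.finrank_self,
      Complex.finrank_real_complex, Finset.sum_const, Finset.card_univ, Fintype.card_fin,
      smul_eq_mul]
    obtain ⟨d, rfl⟩ := Nat.exists_eq_add_of_lt hN
    have : k ≤ 2 * d + 2 := by omega
    rw [Nat.succ_eq_add_one]
    nlinarith
  · intro v hv x
    by_contra h
    obtain ⟨i, q, hq⟩ := exists_eq_insertCombination h
    exact hv x i q hq

theorem frobNorm_pos {A : Matrix (Fin m) (Fin N) ℂ} (hA : A ≠ 0) : 0 < frobNorm A := by
  obtain ⟨i, hi⟩ := Function.ne_iff.1 hA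
  obtain ⟨j, hj⟩ := Function.ne_iff.1 hi
  refine Real.sqrt_pos.2 (Finset.sum_pos' (fun _ _ ↦ by positivity) ⟨i, Finset.mem_univ _, ?_⟩)
  exact Finset.sum_pos' (fun _ _ ↦ by positivity)
    ⟨j, Finset.mem_univ _, pow_pos (norm_pos_iff.2 hj) 2⟩

theorem frobNorm_smul (c : ℝ) (A : Matrix (Fin m) (Fin N) ℂ) :
    frobNorm (c • A) = |c| * frobNorm A := by
  simp only [frobNorm, Matrix.smul_apply, norm_smul, mul_pow, ← Finset.mul_sum]
  rw [Real.sqrt_mul (by positivity), Real.sqrt_sq (norm_nonneg c), Real.norm_eq_abs]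

theorem continuous_frobNorm :
    Continuous (frobNorm : Matrix (Fin m) (Fin N) ℂ → ℝ) := by
  unfold frobNorm
  fun_prop

/-- Full rank matrices of Frobenius norm one, as families of linearly independent rows. -/
def rowsOfSphere :
    C({A : Matrix (Fin m) (Fin N) ℂ // frobNorm A = 1 ∧ Surjective A.mulVecLin},
      {A : Fin m → Fin N → ℂ | LinearIndependent ℂ A}) where
  toFun A := ⟨A.1, A.1.surjective_mulVecLin_iff_linearIndependent.1 A.2.2⟩
  continuous_toFun := continuous_subtype_val.subtype_mk _

theorem ne_zero_of_linearIndependent (hm : 0 < m) {A : Fin m → Fin N → ℂ}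
    (hA : LinearIndependent ℂ A) : A ≠ 0 :=
  fun h ↦ hA.ne_zero ⟨0, hm⟩ (congrFun h _)

/-- The matrix with given linearly independent rows, rescaled to Frobenius norm one. -/
noncomputable def normalizeRows (hm : 0 < m) :
    C({A : Fin m → Fin N → ℂ | LinearIndependent ℂ A},
      {A : Matrix (Fin m) (Fin N) ℂ // frobNorm A = 1 ∧ Surjective A.mulVecLin}) where
  toFun A := ⟨(frobNorm (Matrix.of A.1))⁻¹ • Matrix.of A.1, by
    have hpos : 0 < frobNorm (Matrix.of A.1) :=
      frobNorm_pos (ne_zero_of_linearIndependent hm A.2)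
    refine ⟨?_, ?_⟩
    · rw [frobNorm_smul, abs_of_pos (inv_pos.2 hpos), inv_mul_cancel₀ hpos.ne']
    · rw [Matrix.surjective_mulVecLin_iff_linearIndependent]
      have hc : ((frobNorm (Matrix.of A.1))⁻¹ : ℂ) ≠ 0 :=
        inv_ne_zero (Complex.ofReal_ne_zero.2 hpos.ne')
      convert! A.2.units_smul fun _ ↦ Units.mk0 _ hc using 1
      ext i j
      simp [Units.smul_def]⟩
  continuous_toFun := by
    have hc : Continuous fun A : {A : Fin m → Fin N → ℂ | LinearIndependent ℂ A} ↦
        Matrix.of A.1 := continuous_subtype_val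
    exact (((continuous_frobNorm.comp hc).inv₀ fun A ↦
      (frobNorm_pos (ne_zero_of_linearIndependent hm A.2)).ne').smul hc).subtype_mk _

theorem normalizeRows_rowsOfSphere (hm : 0 < m)
    (A : {A : Matrix (Fin m) (Fin N) ℂ // frobNorm A = 1 ∧ Surjective A.mulVecLin}) :
    normalizeRows hm (rowsOfSphere A) = A := by
  ext1
  change (frobNorm A.1)⁻¹ • A.1 = A.1
  rw [A.2.1, inv_one, one_smul]

theorem subsingleton_homotopyGroup_sphere (hm : 0 < m) (hN : m < N) {k : ℕ}
    (hk : k ≤ 2 * N - 2 * m)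
    (x : {A : Matrix (Fin m) (Fin N) ℂ // frobNorm A = 1 ∧ Surjective A.mulVecLin}) :
    Subsingleton (HomotopyGroup (Fin k)
      {A : Matrix (Fin m) (Fin N) ℂ // frobNorm A = 1 ∧ Surjective A.mulVecLin} x) :=
  GenLoop.subsingleton_homotopyGroup_of_retract rowsOfSphere (normalizeRows hm)
    (normalizeRows_rowsOfSphere hm) x fun p ↦
      GenLoop.homotopic_const_of_dense_translates isOpen_setOfPred_linearIndependent
        (dense_setOf_forall_linearIndependent_add hm hN hk) _ p

end FullRank


/-- For `N > m`, the subspace `S^{2Nm-1} \ Φ(N)` of the unit sphere of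
`Hom(ℂ^N, ℂ^m)`, consisting of the surjective linear maps of Frobenius norm 1,
is `(2N - 2m)`-connected: it is nonempty, path-connected, and all of its homotopy
groups `π_k` vanish for `1 ≤ k ≤ 2N - 2m` (at every base point). -/
theorem surjective_sphere_highly_connected (m N : ℕ) (hm : 0 < m) (hN : m < N) :
    Nonempty {A : Matrix (Fin m) (Fin N) ℂ // frobNorm A = 1 ∧ Surjective A.mulVecLin} ∧
    PathConnectedSpace {A : Matrix (Fin m) (Fin N) ℂ // frobNorm A = 1 ∧ Surjective A.mulVecLin} ∧
    ∀ (x : {A : Matrix (Fin m) (Fin N) ℂ // frobNorm A = 1 ∧ Surjective A.mulVecLin})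
      (k : ℕ), 1 ≤ k → k ≤ 2 * N - 2 * m →
        Subsingleton (π_ k {A : Matrix (Fin m) (Fin N) ℂ // frobNorm A = 1 ∧ Surjective A.mulVecLin} x) := by
  have hne : Nonempty
      {A : Matrix (Fin m) (Fin N) ℂ // frobNorm A = 1 ∧ Surjective A.mulVecLin} := by
    obtain ⟨v, hv⟩ := (dense_setOf_forall_linearIndependent_add hm hN (Nat.zero_le _)
      (fun _ ↦ 0) contDiff_const).nonempty
    exact ⟨normalizeRows hm ⟨v, by simpa using hv 0⟩⟩
  refine ⟨hne, pathConnectedSpace_iff_zerothHomotopy.2 ⟨hne.map Quotient.mk'', ?_⟩,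
    fun x k _ hk ↦ subsingleton_homotopyGroup_sphere hm hN hk x⟩
  obtain ⟨x⟩ := hne
  have := subsingleton_homotopyGroup_sphere hm hN (Nat.zero_le _) x
  exact (HomotopyGroup.pi0EquivZerothHomotopy (x := x)).symm.subsingleton
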